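/- arXiv:2009.07244 — 3 statements merged into one kernel-verified Lean document; each statement's English description precedes it below -/
import Mathlib

section
/- Let (P, Q) be an irreducible pair of real quadratic forms on ℝ³. Then (P, Q) satisfies the (CM) condition if and only if (P, Q) satisfies both the (D) condition and the (R₂) condition. -/
open MeasureTheory Matrix

noncomputable section

abbrev Mat3 := Matrix (Fin 3) (Fin 3) ℝ

def qf (A : Mat3) (ξ : Fin 3 → ℝ) : ℝ := ξ ⬝ᵥ A *ᵥ ξ

def hess (A : Mat3) : Mat3 := (2:ℝ) • A

def OmitsVar (A M : Mat3) (j : Fin 3) : Prop :=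
  ∀ ξ η : Fin 3 → ℝ, (∀ i, i ≠ j → ξ i = η i) → qf A (M *ᵥ ξ) = qf A (M *ᵥ η)

def IrreduciblePair (A B : Mat3) : Prop :=
  LinearIndependent ℝ ![hess A, hess B] ∧
  ¬ ∃ (M : Mat3) (j : Fin 3), IsUnit M.det ∧ OmitsVar A M j ∧ OmitsVar B M j

/-- The Christ–Mockenhaupt condition: `∫_{S¹} |det(x₁ P + x₂ Q)|^{-γ} dσ < ∞` for every
`0 < γ < 2/3`, where `P, Q` are the Hessian matrices of the two forms and the circle is
parametrized by arc length. -/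
def CMCond (A B : Mat3) : Prop :=
  ∀ γ : ℝ, 0 < γ → γ < 2/3 →
    (∫⁻ θ in Set.Icc (0:ℝ) (2 * Real.pi),
      (ENNReal.ofReal |(Real.cos θ • hess A + Real.sin θ • hess B).det|) ^ (-γ)) < ⊤

/-- The (D) condition: for every nonzero `w`, the polynomial
`ξ ↦ det [∇P(ξ), ∇Q(ξ), w]` does not vanish identically. -/
def DCond (A B : Mat3) : Prop :=
  ∀ w : Fin 3 → ℝ, w ≠ 0 →
    ∃ ξ : Fin 3 → ℝ,
      (Matrix.of ![(2:ℝ) • (A *ᵥ ξ), (2:ℝ) • (B *ᵥ ξ), w]).det ≠ 0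

/-- The (R_{d'}) condition: the minimum over all hyperplanes `H ⊂ ℝ³` (parametrized by
injective linear maps `N : ℝ² → ℝ³`, i.e. `3 × 2` matrices of rank `2`) of the maximum over
`(λ₁, λ₂) ∈ ℝ²` of the rank of the restriction of `λ₁ P + λ₂ Q` to `H` equals `d'`. -/
def RCond (A B : Mat3) (d' : ℕ) : Prop :=
  (∃ N : Matrix (Fin 3) (Fin 2) ℝ, N.rank = 2 ∧
    ∀ l1 l2 : ℝ, (Nᵀ * (l1 • hess A + l2 • hess B) * N).rank ≤ d') ∧
  (∀ N : Matrix (Fin 3) (Fin 2) ℝ, N.rank = 2 →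
    ∃ l1 l2 : ℝ, d' ≤ (Nᵀ * (l1 • hess A + l2 • hess B) * N).rank)


def DR (A B : Mat3) : Prop :=
  ∃ p q r m : ℝ, (p ≠ 0 ∨ q ≠ 0) ∧
    ∀ x y : ℝ, (x • A + y • B).det = (p * x + q * y) ^ 2 * (r * x + m * y)

theorem sq_ne {s t : ℝ} (h : s ≠ 0 ∨ t ≠ 0) : s ^ 2 + t ^ 2 ≠ 0 := by
  rcases h with h | h <;> positivity

theorem DR_zero {A B : Mat3} (h : ∀ x y : ℝ, (x • A + y • B).det = 0) : DR A B :=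
  ⟨1, 0, 0, 0, by simp, fun x y => by simp [h]⟩

theorem DR_congr {A B : Mat3} (M : Mat3) (hM : M.det ≠ 0) (h : DR (Mᵀ * A * M) (Mᵀ * B * M)) :
    DR A B := by
  obtain ⟨p, q, r, m, h0, h⟩ := h
  refine ⟨p, q, r / M.det ^ 2, m / M.det ^ 2, h0, fun x y => ?_⟩
  have h1 : x • (Mᵀ * A * M) + y • (Mᵀ * B * M) = Mᵀ * (x • A + y • B) * M := by
    simp [Matrix.mul_add, Matrix.add_mul]
  have h2 := h x y
  rw [h1, det_mul, det_mul, det_transpose] at h2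
  field_simp
  linear_combination h2

theorem DR_pencil {A B : Mat3} (s t : ℝ) (hst : s ≠ 0 ∨ t ≠ 0)
    (h : DR (s • A + t • B) ((-t) • A + s • B)) : DR A B := by
  obtain ⟨p, q, r, m, h0, h⟩ := h
  have hn := sq_ne hst
  set n := s ^ 2 + t ^ 2 with hnd
  refine ⟨p * s - q * t, p * t + q * s, (r * s - m * t) / n ^ 3, (r * t + m * s) / n ^ 3, ?_, fun x y => ?_⟩
  · by_contra! hc
    obtain ⟨h1, h2⟩ := hc
    have e1 : p * n = 0 := by rw [hnd]; linear_combination s * h1 + t * h2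
    have e2 : q * n = 0 := by rw [hnd]; linear_combination (-t) * h1 + s * h2
    simp [hn] at e1 e2
    simp [e1, e2] at h0
  · have h1 := h ((s * x + t * y) / n) ((s * y - t * x) / n)
    have h2 : ((s * x + t * y) / n) • (s • A + t • B) + ((s * y - t * x) / n) • ((-t) • A + s • B)
        = x • A + y • B := by
      ext i j
      simp
      field_simp
      rw [hnd]; ring
    rw [h2] at h1
    rw [h1]
    field_simp
    ring

theorem DR_of_root (A B : Mat3) (a b c d : ℝ)
    (hF : ∀ x y : ℝ, (x • A + y • B).det = a * x^3 + b * x^2 * y + c * x * y^2 + d * y^3)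
    (s t : ℝ) (hst : s^2 + t^2 = 1)
    (h1 : a * s^3 + b * s^2 * t + c * s * t^2 + d * t^3 = 0)
    (h2 : -t * (3 * a * s^2 + 2 * b * s * t + c * t^2) + s * (b * s^2 + 2 * c * s * t + 3 * d * t^2) = 0) :
    DR A B := by
  let α := a * (3 * s * t^2) + b * (-2*s^2*t + t^3) + c * (s^3 - 2 * t^2 * s) + d * (3 * t * s^2)
  let β := a * (-t^3) + b * (t^2 * s) + c * (-t * s^2) + d * s^3
  refine ⟨-t, s, s * α - t * β, t * α + s * β, ?_, fun x y => ?_⟩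
  · by_contra! hc
    simp at hc
    simp [hc] at hst
  · rw [hF]
    obtain ⟨u, hu⟩ : ∃ u, u = s * x + t * y := ⟨_, rfl⟩
    obtain ⟨v, hv⟩ : ∃ v, v = -t * x + s * y := ⟨_, rfl⟩
    have e1 : x = u * s - v * t := by rw [hu, hv]; linear_combination (-x) * hst
    have e2 : y = u * t + v * s := by rw [hu, hv]; linear_combination (-y) * hst
    have e3 : (s * α - t * β) * x + (t * α + s * β) * y = u * α + v * β := by
      rw [hu, hv]; ring
    rw [e3, ← hv, e1, e2]
    simp only [α, β]
    linear_combination u^3 * h1 + u^2 * v * h2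

theorem cubic (A B : Mat3) : ∃ a b c d : ℝ,
    ∀ x y : ℝ, (x • A + y • B).det = a * x^3 + b * x^2 * y + c * x * y^2 + d * y^3 := by
  refine ⟨A.det, (A.adjugate * B).trace, (B.adjugate * A).trace, B.det, fun x y => ?_⟩
  simp only [trace_fin_three, Matrix.mul_apply, Fin.sum_univ_three, adjugate_fin_three, det_fin_three]
  simp
  ring

theorem exists_orth (u v : Fin 3 → ℝ) : ∃ n : Fin 3 → ℝ, n ≠ 0 ∧ u ⬝ᵥ n = 0 ∧ v ⬝ᵥ n = 0 := by
  obtain ⟨n, hn, h⟩ := (exists_mulVec_eq_zero_iff (M := (Matrix.of ![u, v, 0] : Mat3))).2 (by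
    simp [det_fin_three])
  refine ⟨n, hn, ?_, ?_⟩
  · simpa [mulVec] using congrFun h 0
  · simpa [mulVec] using congrFun h 1

theorem mul_of_rows (a b c u v w : Fin 3 → ℝ) :
    (Matrix.of ![a, b, c] : Mat3) * (Matrix.of ![u, v, w] : Mat3)ᵀ =
      Matrix.of ![![a ⬝ᵥ u, a ⬝ᵥ v, a ⬝ᵥ w], ![b ⬝ᵥ u, b ⬝ᵥ v, b ⬝ᵥ w], ![c ⬝ᵥ u, c ⬝ᵥ v, c ⬝ᵥ w]] := by
  ext i j
  fin_cases i <;> fin_cases j <;> simp [Matrix.mul_apply', dotProduct, Fin.sum_univ_three]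

theorem dot_pos {v : Fin 3 → ℝ} (h : v ≠ 0) : v ⬝ᵥ v ≠ 0 := by simpa using h

theorem dot_prod_zero {p a b : Fin 3 → ℝ} (ha : p ⬝ᵥ a = 0) (hb : p ⬝ᵥ b = 0)
    (h : ∀ ξ, p ⬝ᵥ ξ = 0 → (a ⬝ᵥ ξ) * (b ⬝ᵥ ξ) = 0) : a = 0 ∨ b = 0 := by
  by_contra! hc
  have h1 := h a ha
  have h2 := h (a + b) (by simp [ha, hb])
  have k1 := dot_pos hc.1
  have k2 := dot_pos hc.2
  have h3 : b ⬝ᵥ a = 0 := (mul_eq_zero.1 h1).resolve_left k1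
  have h4 : a ⬝ᵥ b = 0 := by rw [dotProduct_comm, h3]
  simp [h3, h4] at h2
  simp_all

theorem four_forms {p1 p2 q1 q2 : Fin 3 → ℝ}
    (h : ∀ ξ, (p1 ⬝ᵥ ξ) * (q2 ⬝ᵥ ξ) = (p2 ⬝ᵥ ξ) * (q1 ⬝ᵥ ξ)) :
    ∃ s t : ℝ, (s ≠ 0 ∨ t ≠ 0) ∧ ((s • p1 + t • p2 = 0 ∧ s • q1 + t • q2 = 0) ∨
      (s • p1 + t • q1 = 0 ∧ s • p2 + t • q2 = 0)) := by
  by_cases hp : p1 = 0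
  · subst hp
    rcases dot_prod_zero (p := 0) (a := p2) (b := q1) (by simp) (by simp)
      (fun ξ _ => by rw [← h]; simp) with h | h
    · exact ⟨1, 0, by simp, Or.inr (by simp [h])⟩
    · exact ⟨1, 0, by simp, Or.inl (by simp [h])⟩
  have hn := dot_pos hp
  have key := dot_prod_zero (p := p1) (a := (p1 ⬝ᵥ p1) • p2 - (p1 ⬝ᵥ p2) • p1)
    (b := (p1 ⬝ᵥ p1) • q1 - (p1 ⬝ᵥ q1) • p1) (by simp; ring) (by simp; ring)
    (fun ξ hξ => by
      have := h ξ
      simp [hξ] at this ⊢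
      tauto)
  rcases key with k | k
  · refine ⟨(p1 ⬝ᵥ p2), -(p1 ⬝ᵥ p1), by simp [hp], Or.inl ⟨?_, ?_⟩⟩
    · rw [← neg_eq_zero, ← k]; module
    · have := dot_prod_zero (p := 0) (a := p1) (b := (p1 ⬝ᵥ p2) • q1 + (-(p1 ⬝ᵥ p1)) • q2) (by simp) (by simp)
        (fun ξ _ => by
          have h1 := h ξ
          have h2 := congrArg (· ⬝ᵥ ξ) k
          simp at h2 ⊢
          have : (p1 ⬝ᵥ ξ) * ((p1 ⬝ᵥ p2) * (q1 ⬝ᵥ ξ) + -((p1 ⬝ᵥ p1) * (q2 ⬝ᵥ ξ))) = 0 := by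
            linear_combination (-(p1 ⬝ᵥ p1)) * h1 - (q1 ⬝ᵥ ξ) * h2
          simpa using this)
      tauto
  · refine ⟨(p1 ⬝ᵥ q1), -(p1 ⬝ᵥ p1), by simp [hp], Or.inr ⟨?_, ?_⟩⟩
    · rw [← neg_eq_zero, ← k]; module
    · have := dot_prod_zero (p := 0) (a := p1) (b := (p1 ⬝ᵥ q1) • p2 + (-(p1 ⬝ᵥ p1)) • q2) (by simp) (by simp)
        (fun ξ _ => by
          have h1 := h ξ
          have h2 := congrArg (· ⬝ᵥ ξ) k
          simp at h2 ⊢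
          have : (p1 ⬝ᵥ ξ) * ((p1 ⬝ᵥ q1) * (p2 ⬝ᵥ ξ) + -((p1 ⬝ᵥ p1) * (q2 ⬝ᵥ ξ))) = 0 := by
            linear_combination (-(p1 ⬝ᵥ p1)) * h1 - (p2 ⬝ᵥ ξ) * h2
          simpa using this)
      tauto

theorem symm_congr {A : Mat3} (M : Mat3) (hA : A.IsSymm) : (Mᵀ * A * M).IsSymm := by
  unfold Matrix.IsSymm
  simp [hA.eq, Matrix.mul_assoc]

/-- the failure of (D) in normalized coordinates gives a double root -/
theorem DR_of_rows {A B : Mat3} (hA : A.IsSymm) (hB : B.IsSymm)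
    (h : ∀ ξ, (A 0 ⬝ᵥ ξ) * (B 1 ⬝ᵥ ξ) = (A 1 ⬝ᵥ ξ) * (B 0 ⬝ᵥ ξ)) : DR A B := by
  obtain ⟨s, t, hst, h1 | h1⟩ := four_forms h
  · apply DR_zero
    intro x y
    refine exists_vecMul_eq_zero_iff.1 ⟨![s, t, 0], ?_, ?_⟩
    · intro h
      have e0 := congrFun h 0
      have e1 := congrFun h 1
      simp at e0 e1
      simp [e0, e1] at hst
    · ext j
      have e0 := congrFun h1.1 j
      have e1 := congrFun h1.2 j
      simp [vecMul, dotProduct, Fin.sum_univ_three] at e0 e1 ⊢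
      linear_combination x * e0 + y * e1
  · apply DR_pencil s t hst
    set C := s • A + t • B with hC
    set E := (-t) • A + s • B
    have r0 : ∀ j, C 0 j = 0 := fun j => by simpa [hC] using congrFun h1.1 j
    have r1 : ∀ j, C 1 j = 0 := fun j => by simpa [hC] using congrFun h1.2 j
    have hCs : C.IsSymm := (hA.smul s).add (hB.smul t)
    have c0 : C 2 0 = 0 := by rw [hCs.apply]; exact r0 2
    have c1 : C 2 1 = 0 := by rw [hCs.apply]; exact r1 2
    refine ⟨0, 1, C 2 2 * (E 0 0 * E 1 1 - E 0 1 * E 1 0), E.det, by simp, fun x y => ?_⟩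
    simp [det_fin_three, r0, r1, c0, c1]
    ring

theorem DR_of_not_D {A B : Mat3} (hA : A.IsSymm) (hB : B.IsSymm) (h : ¬ DCond A B) : DR A B := by
  unfold DCond at h
  push Not at h
  obtain ⟨w, hw, h⟩ := h
  obtain ⟨u, hu, hwu, -⟩ := exists_orth w w
  obtain ⟨v, hv, hwv, huv⟩ := exists_orth w u
  have hw' := dot_pos hw
  have hu' := dot_pos hu
  have hv' := dot_pos hv
  have huw : u ⬝ᵥ w = 0 := by rw [dotProduct_comm, hwu]
  have hvw : v ⬝ᵥ w = 0 := by rw [dotProduct_comm, hwv]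
  have hvu : v ⬝ᵥ u = 0 := by rw [dotProduct_comm, huv]
  let T : Mat3 := Matrix.of ![u, v, w]
  have hT : T * Tᵀ = Matrix.of ![![u ⬝ᵥ u, 0, 0], ![0, v ⬝ᵥ v, 0], ![0, 0, w ⬝ᵥ w]] := by
    simp only [T, mul_of_rows, *]
  have hTd : T.det ≠ 0 := by
    intro h0
    have := congrArg Matrix.det hT
    rw [det_mul, h0] at this
    simp [det_fin_three] at this
    simp_all
  apply DR_congr Tᵀ (by simpa using hTd)
  apply DR_of_rows (symm_congr _ hA) (symm_congr _ hB)
  intro ξ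
  have key := h (Tᵀ *ᵥ ξ)
  have e : ∀ (A : Mat3) i, (Tᵀᵀ * A * Tᵀ) i ⬝ᵥ ξ = T i ⬝ᵥ (A *ᵥ (Tᵀ *ᵥ ξ)) := by
    intro A i
    have : (Tᵀᵀ * A * Tᵀ) *ᵥ ξ = T *ᵥ (A *ᵥ (Tᵀ *ᵥ ξ)) := by
      simp [Matrix.mulVec_mulVec, Matrix.mul_assoc]
    exact congrFun this i
  simp only [e]
  generalize A *ᵥ (Tᵀ *ᵥ ξ) = a at *
  generalize B *ᵥ (Tᵀ *ᵥ ξ) = b at *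
  have k2 : (Matrix.of ![(2:ℝ) • a, (2:ℝ) • b, w] * Tᵀ).det = 0 := by rw [det_mul, key, zero_mul]
  have k3 : (Matrix.of ![(2:ℝ) • a, (2:ℝ) • b, w] * Tᵀ) = Matrix.of ![![2 * (a ⬝ᵥ u), 2 * (a ⬝ᵥ v), 2 * (a ⬝ᵥ w)],
     ![2 * (b ⬝ᵥ u), 2 * (b ⬝ᵥ v), 2 * (b ⬝ᵥ w)], ![0, 0, w ⬝ᵥ w]] := by
    simp only [T, mul_of_rows, *, smul_dotProduct, smul_eq_mul]
  rw [k3] at k2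
  simp [det_fin_three] at k2
  have k4 : (w ⬝ᵥ w) * ((a ⬝ᵥ u) * (b ⬝ᵥ v) - (a ⬝ᵥ v) * (b ⬝ᵥ u)) = 0 := by linear_combination k2 / 4
  have k5 := (mul_eq_zero.1 k4).resolve_left hw'
  have t0 : T 0 = u := rfl
  have t1 : T 1 = v := rfl
  rw [t0, t1, dotProduct_comm u, dotProduct_comm v, dotProduct_comm u, dotProduct_comm v]
  linear_combination k5

theorem det_zero_of_rank {M : Matrix (Fin 2) (Fin 2) ℝ} (h : M.rank < 2) : M.det = 0 := by
  by_contra hc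
  have := rank_of_isUnit M ((isUnit_iff_isUnit_det M).2 (isUnit_iff_ne_zero.2 hc))
  simp at this
  omega

theorem rank_lt_of_det {M : Matrix (Fin 2) (Fin 2) ℝ} (h : M.det = 0) : M.rank < 2 := by
  by_contra hc
  have h2 : M.rank = 2 := le_antisymm (by simpa using M.rank_le_width) (by omega)
  have : LinearIndependent ℝ M.col := by
    rw [linearIndependent_iff_card_eq_finrank_span]
    rw [rank_eq_finrank_span_cols] at h2
    simpa [Set.finrank] using h2.symm
  have := (linearIndependent_cols_iff_isUnit.1 this)
  rw [isUnit_iff_isUnit_det, h] at this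
  simp at this

/-- singular pencils of symmetric 2 x 2 matrices are one dimensional -/
theorem pencil2 (a b c d e f : ℝ) 
    (h : ∀ x y : ℝ, (x * a + y * d) * (x * c + y * f) = (x * b + y * e) ^ 2) :
    ∃ s t : ℝ, (s ≠ 0 ∨ t ≠ 0) ∧ s * a + t * d = 0 ∧ s * b + t * e = 0 ∧ s * c + t * f = 0 := by
  have h1 : a * c = b ^ 2 := by simpa using h 1 0
  have h2 : d * f = e ^ 2 := by simpa using h 0 1
  have h3 : a * f + c * d = 2 * b * e := by linear_combination h 1 1 - h1 - h2
  have h4 : a * f - c * d = 0 := by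
    have : (a * f - c * d) ^ 2 = 0 := by
      linear_combination (a * f + c * d + 2 * b * e) * h3 - 4 * d * f * h1 - 4 * b ^ 2 * h2
    exact pow_eq_zero_iff (two_ne_zero) |>.1 this
  have h5 : a * e - b * d = 0 := by
    have : (a * e - b * d) ^ 2 = 0 := by
      linear_combination a * d * h3 - a ^ 2 * h2 - d ^ 2 * h1
    exact pow_eq_zero_iff (two_ne_zero) |>.1 this
  have h6 : b * f - c * e = 0 := by
    have : (b * f - c * e) ^ 2 = 0 := by
      linear_combination c * f * h3 - c ^ 2 * h2 - f ^ 2 * h1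
    exact pow_eq_zero_iff (two_ne_zero) |>.1 this
  by_cases ha : a = 0
  · by_cases hc : c = 0
    · have hb : b = 0 := by
        subst ha; simpa using h1.symm
      exact ⟨1, 0, by simp, by simp [ha, hb, hc]⟩
    · refine ⟨f, -c, by simp [hc], ?_, ?_, ?_⟩
      · linear_combination h4
      · linear_combination h6
      · ring
  · refine ⟨d, -a, by simp [ha], ?_, ?_, ?_⟩
    · ring
    · linear_combination -h5
    · linear_combination -h4

theorem rank_one2 (a b c : ℝ) (h : a * c = b ^ 2) :
    ∃ σ l m : ℝ, a = σ * l ^ 2 ∧ b = σ * l * m ∧ c = σ * m ^ 2 := by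
  by_cases ha : a = 0
  · subst ha
    have hb : b = 0 := by simpa using h.symm
    exact ⟨c, 0, 1, by simp, by simp [hb], by simp⟩
  · refine ⟨a⁻¹, a, b, by field_simp, by field_simp, ?_⟩
    field_simp; linear_combination h

theorem DR_of_block {A B : Mat3} (hA : A.IsSymm) (hB : B.IsSymm)
    (h : ∀ x y : ℝ, (x * A 0 0 + y * B 0 0) * (x * A 1 1 + y * B 1 1) = (x * A 0 1 + y * B 0 1) ^ 2) :
    DR A B := by
  obtain ⟨s, t, hst, e1, e2, e3⟩ := pencil2 _ _ _ _ _ _ h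
  apply DR_pencil s t hst
  have hE := h (-t) s
  set C := s • A + t • B with hC
  set E := (-t) • A + s • B with hEd
  have hCs : C.IsSymm := (hA.smul s).add (hB.smul t)
  have hEs : E.IsSymm := (hA.smul (-t)).add (hB.smul s)
  have c00 : C 0 0 = 0 := by simpa [hC] using e1
  have c01 : C 0 1 = 0 := by simpa [hC] using e2
  have c11 : C 1 1 = 0 := by simpa [hC] using e3
  have hE' : E 0 0 * E 1 1 = E 0 1 ^ 2 := by simpa [hEd] using hE
  obtain ⟨σ, l, m, f1, f2, f3⟩ := rank_one2 _ _ _ hE'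
  have c10 : C 1 0 = C 0 1 := hCs.apply _ _
  have c20 : C 2 0 = C 0 2 := hCs.apply _ _
  have c21 : C 2 1 = C 1 2 := hCs.apply _ _
  have g10 : E 1 0 = E 0 1 := hEs.apply _ _
  have g20 : E 2 0 = E 0 2 := hEs.apply _ _
  have g21 : E 2 1 = E 1 2 := hEs.apply _ _
  have key : ∀ x y : ℝ, (x • C + y • E).det =
     -(σ * y) * ((l * C 1 2 - m * C 0 2) * x + (l * E 1 2 - m * E 0 2) * y) ^ 2 := by
    intro x y
    simp [det_fin_three, c10, c20, c21, g10, g20, g21, c00, c01, c11, f1, f2, f3]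
    ring
  by_cases h0 : l * C 1 2 - m * C 0 2 = 0 ∧ l * E 1 2 - m * E 0 2 = 0
  · apply DR_zero
    intro x y
    rw [key, h0.1, h0.2]; ring
  · refine ⟨l * C 1 2 - m * C 0 2, l * E 1 2 - m * E 0 2, 0, -σ, by tauto, fun x y => ?_⟩
    rw [key]; ring

theorem DR_of_not_R {A B : Mat3} (hA : A.IsSymm) (hB : B.IsSymm) (N : Matrix (Fin 3) (Fin 2) ℝ)
    (hN : N.rank = 2)
    (h : ∀ l1 l2 : ℝ, (Nᵀ * (l1 • hess A + l2 • hess B) * N).rank < 2) : DR A B := by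
  have hd : (Nᵀ * N).det ≠ 0 := by
    intro h0
    have := rank_lt_of_det h0
    rw [rank_transpose_mul_self] at this
    omega
  obtain ⟨n, hn, h0, h1⟩ := exists_orth (fun i => N i 0) (fun i => N i 1)
  have hn' := dot_pos hn
  let T : Mat3 := Matrix.of ![(fun i => N i 0), (fun i => N i 1), n]
  have hT : T.det ≠ 0 := by
    intro hT
    have k : (T * Tᵀ).det = 0 := by rw [det_mul, hT, zero_mul]
    simp only [T, mul_of_rows] at k
    rw [h0, h1, dotProduct_comm n, dotProduct_comm n, h0, h1] at k
    have k2 : (n ⬝ᵥ n) * (Nᵀ * N).det = 0 := by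
      rw [← k]
      simp only [det_fin_two, det_fin_three, Matrix.mul_apply', ]
      simp [Matrix.of_apply]
      simp [dotProduct, Fin.sum_univ_three]
      ring
    simp_all
  apply DR_congr Tᵀ (by simpa using hT)
  have e : ∀ (A : Mat3) (i j : Fin 2), (Tᵀᵀ * A * Tᵀ) (Fin.castSucc i) (Fin.castSucc j) = (Nᵀ * A * N) i j := by
    intro A i j
    fin_cases i <;> fin_cases j <;> simp [T, Matrix.mul_apply, Fin.sum_univ_three, vecMul, dotProduct]
  have eA : ∀ (A : Mat3), (Tᵀᵀ * A * Tᵀ) 0 0 = (Nᵀ * A * N) 0 0 ∧ (Tᵀᵀ * A * Tᵀ) 0 1 = (Nᵀ * A * N) 0 1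
    ∧ (Tᵀᵀ * A * Tᵀ) 1 1 = (Nᵀ * A * N) 1 1 := fun A => ⟨e A 0 0, e A 0 1, e A 1 1⟩
  apply DR_of_block (symm_congr _ hA) (symm_congr _ hB)
  intro x y
  simp only [eA]
  have k := det_zero_of_rank (h x y)
  have k2 : Nᵀ * (x • hess A + y • hess B) * N = (2 : ℝ) • (x • (Nᵀ * A * N) + y • (Nᵀ * B * N)) := by
    simp [hess, Matrix.mul_add, Matrix.add_mul, smul_smul, mul_comm]
  have sy : ∀ A : Mat3, A.IsSymm → (Nᵀ * A * N) 1 0 = (Nᵀ * A * N) 0 1 := by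
    intro A hA
    have : (Nᵀ * A * N).IsSymm := by
      unfold Matrix.IsSymm
      simp [hA.eq, Matrix.mul_assoc]
    exact this.apply _ _
  rw [k2, det_fin_two] at k
  simp [sy A hA, sy B hB] at k
  linear_combination k / 4

set_option maxHeartbeats 2000000 in
theorem minors_lemma {C : Mat3} (hCs : C.IsSymm) (hadj : C.adjugate = 0) :
    ∀ i l j k, C i k * C l j = C l k * C i j := by
  have aa : ∀ i j, C.adjugate i j = 0 := fun i j => by rw [hadj]; rfl
  have c10 : C 1 0 = C 0 1 := hCs.apply _ _
  have c20 : C 2 0 = C 0 2 := hCs.apply _ _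
  have c21 : C 2 1 = C 1 2 := hCs.apply _ _
  have a00 := aa 0 0
  have a01 := aa 0 1
  have a02 := aa 0 2
  have a11 := aa 1 1
  have a12 := aa 1 2
  have a22 := aa 2 2
  rw [adjugate_fin_three] at a00 a01 a02 a11 a12 a22
  simp [c10, c20, c21, -mul_eq_mul_left_iff, -mul_eq_mul_right_iff] at a00 a01 a02 a11 a12 a22
  intro i l j k
  fin_cases i <;> fin_cases l <;> fin_cases j <;> fin_cases k <;>
    simp only [Fin.zero_eta, Fin.mk_one, Fin.reduceFinMk, c10, c20, c21] <;>
    first | ring1 | linear_combination a00 | linear_combination -a00 | linear_combination a01 | linear_combination -a01 | linear_combination a02 | linear_combination -a02 | linear_combination a11 | linear_combination -a11 | linear_combination a12 | linear_combination -a12 | linear_combination a22 | linear_combination -a22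

set_option maxHeartbeats 2000000 in
theorem adj_lemma {C : Mat3} (hCs : C.IsSymm) (d0 : C.det = 0) (i j k : Fin 3) :
    C.adjugate i j * C.adjugate k j = C.adjugate j j * C.adjugate k i := by
  have c10 : C 1 0 = C 0 1 := hCs.apply _ _
  have c20 : C 2 0 = C 0 2 := hCs.apply _ _
  have c21 : C 2 1 = C 1 2 := hCs.apply _ _
  rw [det_fin_three] at d0
  simp only [c10, c20, c21] at d0
  rw [adjugate_fin_three]
  fin_cases i <;> fin_cases k <;> fin_cases j <;>
    simp [c10, c20, c21, -mul_eq_mul_left_iff, -mul_eq_mul_right_iff] <;>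
    first | ring1 | linear_combination (C 0 0) * d0 | linear_combination (-C 0 0) * d0 | linear_combination (C 0 1) * d0 | linear_combination (-C 0 1) * d0 | linear_combination (C 0 2) * d0 | linear_combination (-C 0 2) * d0 | linear_combination (C 1 1) * d0 | linear_combination (-C 1 1) * d0 | linear_combination (C 1 2) * d0 | linear_combination (-C 1 2) * d0 | linear_combination (C 2 2) * d0 | linear_combination (-C 2 2) * d0

theorem not_D_R_of_DR {A B : Mat3} (hA : A.IsSymm) (hB : B.IsSymm) (h : DR A B) (hD : DCond A B)
    (hR : RCond A B 2) : False := by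
  obtain ⟨p, q, r, m, hpq, h⟩ := h
  have hn := sq_ne hpq
  set C := q • A + (-p) • B with hC
  set E := p • A + q • B with hE
  have hCs : C.IsSymm := (hA.smul q).add (hB.smul (-p))
  have hEs : E.IsSymm := (hA.smul p).add (hB.smul q)
  have key : ∀ v : ℝ, (C + v • E).det = v ^ 2 * (p ^ 2 + q ^ 2) ^ 2 * (r * (q + v * p) + m * (-p + v * q)) := by
    intro v
    have : C + v • E = (q + v * p) • A + (-p + v * q) • B := by
      rw [hC, hE]; module
    rw [this, h]; ring
  have d0 : C.det = 0 := by simpa using key 0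
  have d1 : (C.adjugate * E).trace = 0 := by
    have ex : ∀ v : ℝ, (C + v • E).det = C.det + v * (C.adjugate * E).trace + v ^ 2 * (E.adjugate * C).trace
        + v ^ 3 * E.det := by
      intro v
      simp only [trace_fin_three, Matrix.mul_apply, Fin.sum_univ_three, adjugate_fin_three, det_fin_three]
      simp
      ring
    have k1 := key 1
    have k2 := key (-1)
    have k3 := key 2
    rw [ex] at k1 k2 k3
    rw [d0] at k1 k2 k3
    linear_combination k1 - k2/3 - k3 / 6
  by_cases hadj : C.adjugate = 0
  · -- rank at most one
    have minors := minors_lemma hCs hadj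
    obtain ⟨w, hw, hwC⟩ : ∃ w : Fin 3 → ℝ, w ≠ 0 ∧ ∀ ξ i l, (C *ᵥ ξ) i * w l = (C *ᵥ ξ) l * w i := by
      by_cases hC0 : C = 0
      · exact ⟨fun _ => 1, fun h => by simpa using congrFun h 0, fun ξ i l => by simp [hC0]⟩
      · obtain ⟨j, hj⟩ : ∃ j, (fun i => C i j) ≠ 0 := by
          by_contra! hc
          exact hC0 (by ext i j; exact congrFun (hc j) i)
        refine ⟨_, hj, fun ξ i l => ?_⟩
        simp only [mulVec, dotProduct, Finset.sum_mul]
        refine Finset.sum_congr rfl fun k _ => ?_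
        linear_combination ξ k * minors i l j k
    obtain ⟨ξ, hξ⟩ := hD w hw
    apply hξ
    have hh := hwC ξ
    have cv : C *ᵥ ξ = q • (A *ᵥ ξ) - p • (B *ᵥ ξ) := by
      rw [hC, add_mulVec, smul_mulVec, smul_mulVec]; module
    rw [cv] at hh
    generalize A *ᵥ ξ = a at *
    generalize B *ᵥ ξ = b at *
    have k01 := hh 0 1
    have k02 := hh 0 2
    have k12 := hh 1 2
    simp at k01 k02 k12
    have big : (p ^ 2 + q ^ 2) * (Matrix.of ![(2:ℝ) • a, (2:ℝ) • b, w]).det = 0 := by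
      simp only [det_fin_three]
      simp [-mul_eq_zero]
      linear_combination 4 * ((p * a 0 + q * b 0) * (-k12) + (p * a 1 + q * b 1) * k02 - (p * a 2 + q * b 2) * k01) 
    exact (mul_eq_zero.1 big).resolve_left hn
  · -- rank two
    have c10 : C 1 0 = C 0 1 := hCs.apply _ _
    have c20 : C 2 0 = C 0 2 := hCs.apply _ _
    have c21 : C 2 1 = C 1 2 := hCs.apply _ _
    obtain ⟨j, hj⟩ : ∃ j, (fun i => C.adjugate i j) ≠ 0 := by
      by_contra! hc
      exact hadj (by ext i j; exact congrFun (hc j) i)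
    set v := (fun i => C.adjugate i j) with hv
    have hCv : C *ᵥ v = 0 := by
      have : C * C.adjugate = 0 := by rw [mul_adjugate, d0, zero_smul]
      ext i
      exact congrFun (congrFun this i) j
    have vv : ∀ i k, v i * v k = C.adjugate j j * C.adjugate k i := fun i k => adj_lemma hCs d0 i j k
    have hvEv : v ⬝ᵥ (E *ᵥ v) = 0 := by
      have : v ⬝ᵥ (E *ᵥ v) = C.adjugate j j * (C.adjugate * E).trace := by
        simp only [dotProduct, mulVec, trace, diag, Matrix.mul_apply, Finset.mul_sum]
        rw [Finset.sum_comm]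
        refine Finset.sum_congr rfl fun i _ => Finset.sum_congr rfl fun k _ => ?_
        linear_combination E k i * vv k i
      rw [this, d1, mul_zero]
    obtain ⟨n, hn0, hvn, hun⟩ := exists_orth v (E *ᵥ v)
    let N : Matrix (Fin 3) (Fin 2) ℝ := Matrix.of fun i k => ![v i, n i] k
    have nn : ∀ (G : Mat3), Nᵀ * G * N = !![v ⬝ᵥ (G *ᵥ v), v ⬝ᵥ (G *ᵥ n); n ⬝ᵥ (G *ᵥ v), n ⬝ᵥ (G *ᵥ n)] := by
      intro G
      ext i j
      fin_cases i <;> fin_cases j <;> 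
        simp [N, Matrix.mul_apply, dotProduct, mulVec, Fin.sum_univ_three] <;> ring
    have hNr : N.rank = 2 := by
      rw [← rank_transpose_mul_self]
      by_contra hc
      have hlt : (Nᵀ * N).rank < 2 := lt_of_le_of_ne (by simpa using (Nᵀ * N).rank_le_width) hc
      have hdet := det_zero_of_rank hlt
      have := nn 1
      rw [Matrix.mul_one] at this
      rw [this, det_fin_two] at hdet
      simp only [one_mulVec] at hdet
      simp [hvn, hj, hn0] at hdet
    obtain ⟨l1, l2, hl⟩ := hR.2 N hNr
    have : (Nᵀ * (l1 • hess A + l2 • hess B) * N).det = 0 := by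
      obtain ⟨x, y, hxy⟩ : ∃ x y : ℝ, l1 • hess A + l2 • hess B = x • C + y • E := by
        refine ⟨2 * (l1 * q - l2 * p) / (p ^ 2 + q ^ 2), 2 * (l1 * p + l2 * q) / (p ^ 2 + q ^ 2), ?_⟩
        ext i j
        simp [hess, hC, hE]
        field_simp
        ring
      rw [hxy, nn, det_fin_two]
      have e1 : (x • C + y • E) *ᵥ v = y • (E *ᵥ v) := by
        rw [add_mulVec, smul_mulVec, smul_mulVec, hCv]; simp
      have e2 : n ⬝ᵥ (E *ᵥ v) = 0 := by rw [dotProduct_comm, hun]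
      simp [e1, hvEv, e2]
    have := rank_lt_of_det this
    omega

theorem R_first (A B : Mat3) : ∃ N : Matrix (Fin 3) (Fin 2) ℝ, N.rank = 2 ∧
    ∀ l1 l2 : ℝ, (Nᵀ * (l1 • hess A + l2 • hess B) * N).rank ≤ 2 := by
  refine ⟨!![1, 0; 0, 1; 0, 0], ?_, fun l1 l2 => by simpa using rank_le_width _⟩
  rw [← rank_transpose_mul_self]
  have : (!![1, 0; 0, 1; 0, 0] : Matrix (Fin 3) (Fin 2) ℝ)ᵀ * (!![1, 0; 0, 1; 0, 0] : Matrix (Fin 3) (Fin 2) ℝ) = (1 : Matrix (Fin 2) (Fin 2) ℝ) := by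
    ext i j
    fin_cases i <;> fin_cases j <;> simp [Matrix.mul_apply, Fin.sum_univ_three]
  rw [this, rank_one]; simp

theorem alg {A B : Mat3} (hA : A.IsSymm) (hB : B.IsSymm) : ¬ DR A B ↔ (DCond A B ∧ RCond A B 2) := by
  constructor
  · intro h
    refine ⟨by_contra fun hc => h (DR_of_not_D hA hB hc), R_first A B, fun N hN => ?_⟩
    by_contra! hc
    exact h (DR_of_not_R hA hB N hN hc)
  · rintro ⟨h1, h2⟩ h
    exact not_D_R_of_DR hA hB h h1 h2

theorem ennreal_anti {a b : ENNReal} {γ : ℝ} (hγ : 0 ≤ γ) (h : a ≤ b) : b ^ (-γ) ≤ a ^ (-γ) := by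
  rw [ENNReal.rpow_neg, ENNReal.rpow_neg]
  exact ENNReal.inv_le_inv.2 (ENNReal.rpow_le_rpow h hγ)

theorem det_hess (A B : Mat3) (x y : ℝ) :
    (x • hess A + y • hess B).det = 8 * (x • A + y • B).det := by
  have : x • hess A + y • hess B = (2:ℝ) • (x • A + y • B) := by
    simp only [hess]; module
  rw [this, det_smul]
  norm_num

theorem not_CM_of_DR {A B : Mat3} (h : DR A B) : ¬ CMCond A B := by
  intro hCM
  obtain ⟨p, q, r, m, hpq, h⟩ := h
  have hfin := hCM (1/2) (by norm_num) (by norm_num)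
  obtain ⟨θ₀, hθ, hz⟩ : ∃ θ ∈ Set.Icc (0:ℝ) Real.pi, p * Real.cos θ + q * Real.sin θ = 0 := by
    have hc : ContinuousOn (fun θ => p * Real.cos θ + q * Real.sin θ) (Set.uIcc 0 Real.pi) := by fun_prop
    have := intermediate_value_uIcc hc
    have h0 : (0:ℝ) ∈ Set.uIcc (p * Real.cos 0 + q * Real.sin 0) (p * Real.cos Real.pi + q * Real.sin Real.pi) := by
      simp [Set.mem_uIcc]
      rcases le_total p 0 with h | h <;> simp [h]
    obtain ⟨θ, h1, h2⟩ := this h0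
    exact ⟨θ, by rwa [Set.uIcc_of_le Real.pi_pos.le] at h1, h2⟩
  set K : ℝ := |p| + |q| with hK
  set K2 : ℝ := 8 * (|r| + |m|) + 1 with hK2
  have hKpos : 0 < K := by
    rcases hpq with h | h
    · have := abs_pos.2 h; positivity
    · have := abs_pos.2 h; positivity
  have hK2pos : 0 < K2 := by positivity
  have bound : ∀ θ : ℝ, |(Real.cos θ • hess A + Real.sin θ • hess B).det| ≤ K2 * K ^ 2 * (θ - θ₀) ^ 2 := by
    intro θ
    rw [det_hess, h, abs_mul, abs_mul, abs_pow]
    have b1 : |p * Real.cos θ + q * Real.sin θ| ≤ K * |θ - θ₀| := by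
      have e : p * Real.cos θ + q * Real.sin θ = p * (Real.cos θ - Real.cos θ₀) + q * (Real.sin θ - Real.sin θ₀) := by
        linear_combination hz
      rw [e]
      refine (abs_add_le _ _).trans ?_
      rw [abs_mul, abs_mul, hK, add_mul]
      exact add_le_add (mul_le_mul_of_nonneg_left (Real.abs_cos_sub_cos_le _ _) (abs_nonneg _))
        (mul_le_mul_of_nonneg_left (Real.abs_sin_sub_sin_le _ _) (abs_nonneg _))
    have b2 : |r * Real.cos θ + m * Real.sin θ| ≤ |r| + |m| := by
      refine (abs_add_le _ _).trans ?_
      rw [abs_mul, abs_mul]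
      have := Real.abs_cos_le_one θ
      have := Real.abs_sin_le_one θ
      nlinarith [abs_nonneg r, abs_nonneg m]
    calc |(8:ℝ)| * (|p * Real.cos θ + q * Real.sin θ| ^ 2 * |r * Real.cos θ + m * Real.sin θ|)
        ≤ 8 * ((K * |θ - θ₀|) ^ 2 * (|r| + |m|)) := by
          rw [abs_of_pos (by norm_num : (0:ℝ) < 8)]
          gcongr
      _ = (8 * (|r| + |m|)) * (K ^ 2 * (θ - θ₀) ^ 2) := by rw [mul_pow, sq_abs]; ring
      _ ≤ K2 * (K ^ 2 * (θ - θ₀) ^ 2) := by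
          gcongr; rw [hK2]; linarith
      _ = _ := by ring
  have hpi := Real.pi_pos
  set D : ℝ := Real.sqrt (K2 * K ^ 2) with hD
  have hDpos : 0 < D := Real.sqrt_pos.2 (by positivity)
  have hDsq : D ^ 2 = K2 * K ^ 2 := Real.sq_sqrt (by positivity)
  have hfin2 : (∫⁻ θ in Set.Ioc θ₀ (2 * Real.pi), ENNReal.ofReal (D⁻¹ * (θ - θ₀)⁻¹)) < ⊤ := by
    refine lt_of_le_of_lt ?_ hfin
    refine le_trans (setLIntegral_mono' measurableSet_Ioc ?_)
      (lintegral_mono_set (s := Set.Ioc θ₀ (2 * Real.pi)) (t := Set.Icc 0 (2 * Real.pi)) ?_)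
    · intro θ hθ'
      have ht : 0 < θ - θ₀ := sub_pos.2 hθ'.1
      refine le_trans ?_ (ennreal_anti (by norm_num) (ENNReal.ofReal_le_ofReal (bound θ)))
      rw [ENNReal.ofReal_rpow_of_pos (by positivity)]
      apply ENNReal.ofReal_le_ofReal
      apply le_of_eq
      rw [← hDsq, ← mul_pow, Real.rpow_neg (by positivity), ← Real.sqrt_eq_rpow, Real.sqrt_sq (by positivity), mul_inv]
    · intro θ hθ'
      exact ⟨hθ.1.trans hθ'.1.le, hθ'.2⟩
  have hint : IntegrableOn (fun θ => D⁻¹ * (θ - θ₀)⁻¹) (Set.Ioc θ₀ (2 * Real.pi)) := by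
    refine ⟨by fun_prop, ?_⟩
    rw [hasFiniteIntegral_iff_ofReal]
    · exact hfin2
    · filter_upwards [ae_restrict_mem measurableSet_Ioc] with θ hθ'
      have ht : 0 < θ - θ₀ := sub_pos.2 hθ'.1
      simp only [Pi.zero_apply]
      positivity
  have hle : θ₀ ≤ 2 * Real.pi := by linarith [hθ.2]
  have hint2 : IntervalIntegrable (fun θ => (θ - θ₀)⁻¹) volume θ₀ (2 * Real.pi) := by
    rw [intervalIntegrable_iff_integrableOn_Ioc_of_le hle]
    have : IntegrableOn (fun θ => D * (D⁻¹ * (θ - θ₀)⁻¹)) (Set.Ioc θ₀ (2 * Real.pi)) := Integrable.const_mul hint D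
    refine this.congr_fun ?_ measurableSet_Ioc
    intro x _
    simp only
    field_simp
  rw [intervalIntegrable_sub_inv_iff] at hint2
  rcases hint2 with h | h
  · linarith [hθ.2]
  · exact h Set.left_mem_uIcc

theorem lint_rpow {γ δ : ℝ} (h1 : γ < 1) (x₀ : ℝ) (hδ : 0 < δ) :
    (∫⁻ x in Set.Ioo (x₀ - δ) (x₀ + δ), ENNReal.ofReal (|x - x₀| ^ (-γ))) < ⊤ := by
  have hI : IntervalIntegrable (fun x : ℝ => |x| ^ (-γ)) volume (-δ) δ := by
    have k : IntervalIntegrable (fun x : ℝ => |x| ^ (-γ)) volume 0 δ := by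
      have := intervalIntegral.intervalIntegrable_rpow' (a := 0) (b := δ) (r := -γ) (by linarith)
      refine this.congr ?_
      intro x hx
      rw [Set.uIoc_of_le hδ.le] at hx
      simp only [abs_of_pos hx.1]
    have k2 : IntervalIntegrable (fun x : ℝ => |x| ^ (-γ)) volume 0 (-δ) := by
      rw [IntervalIntegrable.iff_comp_neg]
      simpa using k
    exact k2.symm.trans k
  have hJ := hI.comp_sub_right x₀
  rw [intervalIntegrable_iff_integrableOn_Ioo_of_le (by linarith)] at hJ
  have := hJ.2
  rw [hasFiniteIntegral_iff_ofReal (by filter_upwards with x; simp only [Pi.zero_apply]; positivity)] at this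
  rwa [show -δ + x₀ = x₀ - δ by ring, show δ + x₀ = x₀ + δ by ring] at this

theorem CM_of_not_DR {A B : Mat3} (h : ¬ DR A B) : CMCond A B := by
  intro γ hγ hγ2
  obtain ⟨a, b, c, d, hF⟩ := cubic A B
  set g : ℝ → ℝ := fun θ => (Real.cos θ • hess A + Real.sin θ • hess B).det with hg
  have hgF : g = fun θ => 8 * (a * Real.cos θ ^ 3 + b * Real.cos θ ^ 2 * Real.sin θ + c * Real.cos θ * Real.sin θ ^ 2
      + d * Real.sin θ ^ 3) := by
    ext θ
    simp only [hg]
    rw [det_hess, hF]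
  have hgc : Continuous g := by rw [hgF]; fun_prop
  have hgd : ∀ θ, HasDerivAt g (8 * (-Real.sin θ * (3 * a * Real.cos θ ^ 2 + 2 * b * Real.cos θ * Real.sin θ + c * Real.sin θ ^ 2)
      + Real.cos θ * (b * Real.cos θ ^ 2 + 2 * c * Real.cos θ * Real.sin θ + 3 * d * Real.sin θ ^ 2))) θ := by
    intro θ
    rw [hgF]
    have hc := Real.hasDerivAt_cos θ
    have hs := Real.hasDerivAt_sin θ
    have := (((((hc.pow 3).const_mul a).add (((hc.pow 2).const_mul b).mul hs)).add
      ((hc.const_mul c).mul (hs.pow 2))).add ((hs.pow 3).const_mul d)).const_mul 8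
    refine this.congr_deriv ?_
    simp
    ring
  have loc : ∀ θ₀, ∃ k > 0, ∀ᶠ θ in nhds θ₀, k * |θ - θ₀| ≤ |g θ| := by
    intro θ₀
    by_cases h0 : g θ₀ = 0
    · have hd := hgd θ₀
      set g' := (8 * (-Real.sin θ₀ * (3 * a * Real.cos θ₀ ^ 2 + 2 * b * Real.cos θ₀ * Real.sin θ₀ + c * Real.sin θ₀ ^ 2)
      + Real.cos θ₀ * (b * Real.cos θ₀ ^ 2 + 2 * c * Real.cos θ₀ * Real.sin θ₀ + 3 * d * Real.sin θ₀ ^ 2))) with hg'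
      have hne : g' ≠ 0 := by
        intro hz
        apply h
        refine DR_of_root A B a b c d hF (Real.cos θ₀) (Real.sin θ₀) (by simp) ?_ ?_
        · rw [hgF] at h0
          simp only at h0
          linarith
        · rw [hg'] at hz; linarith
      have hp : 0 < |g'| := abs_pos.2 hne
      refine ⟨|g'| / 2, by positivity, ?_⟩
      have := (hasDerivAt_iff_isLittleO.1 hd).def (c := |g'| / 2) (by positivity)
      filter_upwards [this] with θ hθ
      rw [h0] at hθ
      simp only [sub_zero, smul_eq_mul, Real.norm_eq_abs] at hθ
      have t1 : |(θ - θ₀) * g'| ≤ |g θ| + |g θ - (θ - θ₀) * g'| := by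
        have := abs_sub_abs_le_abs_sub ((θ - θ₀) * g') (g θ)
        rw [abs_sub_comm] at this
        linarith
      rw [abs_mul] at t1
      linarith
    · have hp : 0 < |g θ₀| := abs_pos.2 h0
      refine ⟨|g θ₀| / 2, by positivity, ?_⟩
      have e1 : ∀ᶠ θ in nhds θ₀, |g θ₀| / 2 < |g θ| :=
        (hgc.abs.tendsto θ₀).eventually_const_lt (by linarith)
      filter_upwards [e1, Metric.ball_mem_nhds θ₀ one_pos] with θ h1 h2
      rw [Metric.mem_ball, Real.dist_eq] at h2
      nlinarith
  have hcomp := IsCompact.measure_lt_top_of_nhdsWithin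
    (μ := volume.withDensity (fun θ => (ENNReal.ofReal |g θ|) ^ (-γ))) (isCompact_Icc (a := (0:ℝ)) (b := 2 * Real.pi)) (by
    intro θ₀ _
    obtain ⟨k, hk, hev⟩ := loc θ₀
    obtain ⟨δ, hδ, hb⟩ := Metric.eventually_nhds_iff_ball.1 hev
    refine ⟨Set.Ioo (θ₀ - δ) (θ₀ + δ), mem_nhdsWithin_of_mem_nhds (Ioo_mem_nhds (by linarith) (by linarith)), ?_⟩
    rw [withDensity_apply _ measurableSet_Ioo]
    have hfin := lint_rpow (γ := γ) (by linarith) θ₀ hδ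
    have hfin2 : (∫⁻ x in Set.Ioo (θ₀ - δ) (θ₀ + δ), ENNReal.ofReal (k ^ (-γ)) * ENNReal.ofReal (|x - θ₀| ^ (-γ))) < ⊤ := by
      rw [lintegral_const_mul' _ _ ENNReal.ofReal_ne_top]
      exact ENNReal.mul_lt_top ENNReal.ofReal_lt_top hfin
    refine lt_of_le_of_lt (lintegral_mono_ae ?_) hfin2
    have hne : ∀ᵐ x ∂(volume.restrict (Set.Ioo (θ₀ - δ) (θ₀ + δ))), x ≠ θ₀ :=
      ae_restrict_of_ae (Measure.ae_ne volume θ₀)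
    filter_upwards [hne, ae_restrict_mem measurableSet_Ioo] with x hx hx2
    have hpos : 0 < |x - θ₀| := abs_pos.2 (sub_ne_zero.2 hx)
    have hxb : k * |x - θ₀| ≤ |g x| := hb x (by rw [Real.ball_eq_Ioo]; exact hx2)
    refine (ennreal_anti hγ.le (ENNReal.ofReal_le_ofReal hxb)).trans (le_of_eq ?_)
    rw [ENNReal.ofReal_rpow_of_pos (by positivity), ← ENNReal.ofReal_mul (by positivity),
      Real.mul_rpow hk.le hpos.le])
  rwa [withDensity_apply _ measurableSet_Icc] at hcomp

theorem cm_iff_d_and_r2 (A B : Mat3) (hAs : A.IsSymm) (hBs : B.IsSymm)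
    (hirr : IrreduciblePair A B) :
    CMCond A B ↔ (DCond A B ∧ RCond A B 2) := by
  rw [← alg hAs hBs]
  exact ⟨fun h h' => not_CM_of_DR h' h, CM_of_not_DR⟩
end
end

section
/- Let (P, Q) be an irreducible pair of real quadratic forms on ℝ³ that fails the (D) condition. Then (P, Q) is equivalent to (ξ₁² + ξ₂², ξ₃²), or to (ξ₁² − ξ₂², ξ₃²), or to (ξ₁ξ₂ + ξ₃², ξ₁²). -/
open MeasureTheory Matrix

noncomputable section

/-- The pair of quadratic forms `(qf A, qf B)` is equivalent to the pair `(p, q)`: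
there are invertible matrices `M₁ ∈ GL₃(ℝ)`, `M₂ ∈ GL₂(ℝ)` with
`(p(ξ), q(ξ))ᵀ = M₂ ⬝ (qf A (M₁ ξ), qf B (M₁ ξ))ᵀ` for every `ξ`. -/
def EquivPair (A B : Mat3) (p q : (Fin 3 → ℝ) → ℝ) : Prop :=
  ∃ (M1 : Mat3) (M2 : Matrix (Fin 2) (Fin 2) ℝ), IsUnit M1.det ∧ IsUnit M2.det ∧
    ∀ ξ : Fin 3 → ℝ,
      p ξ = M2 0 0 * qf A (M1 *ᵥ ξ) + M2 0 1 * qf B (M1 *ᵥ ξ) ∧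
      q ξ = M2 1 0 * qf A (M1 *ᵥ ξ) + M2 1 1 * qf B (M1 *ᵥ ξ)

def Irr2 (A B : Mat3) : Prop :=
  (∀ a b : ℝ, a • A + b • B = 0 → a = 0 ∧ b = 0) ∧
  ∀ v : Fin 3 → ℝ, A *ᵥ v = 0 → B *ᵥ v = 0 → v = 0

theorem qf_add_ker (A : Mat3) (hA : A.IsSymm) (x v : Fin 3 → ℝ) (t : ℝ) (hv : A *ᵥ v = 0) :
    qf A (x + t • v) = qf A x := by
  have h1 : v ⬝ᵥ A *ᵥ x = 0 := by
    rw [Matrix.dotProduct_mulVec, ← Matrix.mulVec_transpose, hA.eq, hv, zero_dotProduct]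
  simp [qf, Matrix.mulVec_add, Matrix.mulVec_smul, hv, h1]

theorem irr2_of (A B : Mat3) (hAs : A.IsSymm) (hBs : B.IsSymm)
    (h : IrreduciblePair A B) : Irr2 A B := by
  obtain ⟨h1, h2⟩ := h
  refine ⟨fun a b hab => ?_, fun v hA hB => ?_⟩
  · rw [LinearIndependent.pair_iff] at h1
    apply h1
    simp only [hess]
    rw [smul_comm a, smul_comm b, ← smul_add, hab, smul_zero]
  · by_contra hv
    obtain ⟨j, hj⟩ := Function.ne_iff.mp hv
    apply h2
    have key : ∀ ξ η : Fin 3 → ℝ, (∀ i, i ≠ j → ξ i = η i) →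
        ((1 : Mat3).updateCol j v) *ᵥ η
          = ((1 : Mat3).updateCol j v) *ᵥ ξ + (η j - ξ j) • v := by
      intro ξ η h
      have e : η = ξ + (η j - ξ j) • Pi.single j (1:ℝ) := by
        ext i
        by_cases hi : i = j
        · subst hi; simp
        · simp [hi, h i hi]
      conv_lhs => rw [e]
      rw [Matrix.mulVec_add, Matrix.mulVec_smul, Matrix.mulVec_single_one]
      congr 2
      ext i
      simp [Matrix.col]
    refine ⟨(1 : Mat3).updateCol j v, j, ?_, ?_, ?_⟩
    · have : ((1 : Mat3).updateCol j v).det = v j := by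
        fin_cases j <;> simp [Matrix.det_fin_three, Matrix.updateCol_apply]
      rw [this]
      exact isUnit_iff_ne_zero.mpr hj
    · intro ξ η h
      rw [key ξ η h, qf_add_ker A hAs _ _ _ hA]
    · intro ξ η h
      rw [key ξ η h, qf_add_ker B hBs _ _ _ hB]

theorem qf_congr (A M : Mat3) (x : Fin 3 → ℝ) : qf (Mᵀ * A * M) x = qf A (M *ᵥ x) := by
  simp only [qf]
  rw [Matrix.mul_assoc, ← Matrix.mulVec_mulVec, ← Matrix.mulVec_mulVec, Matrix.dotProduct_mulVec,
    Matrix.vecMul_transpose]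

theorem equiv_congr (A B M : Mat3) (hM : IsUnit M.det) (p q : (Fin 3 → ℝ) → ℝ)
    (h : EquivPair (Mᵀ * A * M) (Mᵀ * B * M) p q) : EquivPair A B p q := by
  obtain ⟨M1, M2, h1, h2, h3⟩ := h
  refine ⟨M * M1, M2, ?_, h2, ?_⟩
  · rw [Matrix.det_mul]; exact hM.mul h1
  · intro ξ
    have := h3 ξ
    simpa only [qf_congr, Matrix.mulVec_mulVec] using this

theorem qf_lin (A B : Mat3) (a b : ℝ) (x : Fin 3 → ℝ) :
    qf (a • A + b • B) x = a * qf A x + b * qf B x := by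
  simp [qf, Matrix.add_mulVec, Matrix.smul_mulVec]

theorem equiv_pencil (A B : Mat3) (a b c d : ℝ) (hN : a * d - b * c ≠ 0)
    (p q : (Fin 3 → ℝ) → ℝ)
    (h : EquivPair (a • A + b • B) (c • A + d • B) p q) : EquivPair A B p q := by
  obtain ⟨M1, M2, h1, h2, h3⟩ := h
  refine ⟨M1, M2 * !![a, b; c, d], h1, ?_, ?_⟩
  · rw [Matrix.det_mul]
    refine h2.mul ?_
    rw [Matrix.det_fin_two_of]
    exact isUnit_iff_ne_zero.mpr hN
  · intro ξ
    obtain ⟨e1, e2⟩ := h3 ξ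
    rw [e1, e2]
    simp only [qf_lin, Matrix.mul_apply, Fin.sum_univ_two]
    constructor <;> simp <;> ring

theorem irr2_congr (A B M : Mat3) (hM : IsUnit M.det) (h : Irr2 A B) :
    Irr2 (Mᵀ * A * M) (Mᵀ * B * M) := by
  have hMu : IsUnit M := (Matrix.isUnit_iff_isUnit_det M).mpr hM
  have hMt : IsUnit Mᵀ := by
    rw [Matrix.isUnit_iff_isUnit_det, Matrix.det_transpose]; exact hM
  refine ⟨fun a b hab => h.1 a b ?_, fun v hA hB => ?_⟩
  · have : Mᵀ * (a • A + b • B) * M = 0 := by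
      rw [← hab]; simp [Matrix.mul_add, Matrix.add_mul]
    have h2 := (hMu.mul_left_eq_zero).mp this
    exact (hMt.mul_right_eq_zero).mp h2
  · have inj := Matrix.mulVec_injective_of_isUnit hMu
    have injt := Matrix.mulVec_injective_of_isUnit hMt
    have : M *ᵥ v = 0 := by
      apply h.2
      · apply injt; simpa [Matrix.mul_assoc] using hA
      · apply injt; simpa [Matrix.mul_assoc] using hB
    apply inj; simpa using this

theorem irr2_pencil (A B : Mat3) (a b c d : ℝ) (hN : a * d - b * c ≠ 0) (h : Irr2 A B) :
    Irr2 (a • A + b • B) (c • A + d • B) := by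
  refine ⟨fun s t hst => ?_, fun v hA hB => ?_⟩
  · obtain ⟨e1, e2⟩ := h.1 (s * a + t * c) (s * b + t * d) (by rw [← hst]; module)
    constructor
    · have : s * (a * d - b * c) = 0 := by linear_combination d * e1 - c * e2
      exact (mul_eq_zero.mp this).resolve_right hN
    · have : t * (a * d - b * c) = 0 := by linear_combination a * e2 - b * e1
      exact (mul_eq_zero.mp this).resolve_right hN
  · rw [Matrix.add_mulVec, Matrix.smul_mulVec, Matrix.smul_mulVec] at hA hB
    apply h.2
    · have : (a * d - b * c) • (A *ᵥ v) = 0 := by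
        have : (a * d - b * c) • (A *ᵥ v) = d • (a • A *ᵥ v + b • B *ᵥ v)
          - b • (c • A *ᵥ v + d • B *ᵥ v) := by module
        rw [this, hA, hB]; simp
      exact (smul_eq_zero.mp this).resolve_left hN
    · have : (a * d - b * c) • (B *ᵥ v) = 0 := by
        have : (a * d - b * c) • (B *ᵥ v) = a • (c • A *ᵥ v + d • B *ᵥ v)
          - c • (a • A *ᵥ v + b • B *ᵥ v) := by module
        rw [this, hA, hB]; simp
      exact (smul_eq_zero.mp this).resolve_left hN

section forms
variable {V : Type*} [AddCommGroup V] [Module ℝ V]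

theorem lin_prod_zero (f g : V →ₗ[ℝ] ℝ) (h : ∀ x, f x * g x = 0) : f = 0 ∨ g = 0 := by
  by_contra! hc
  obtain ⟨hf, hg⟩ := hc
  obtain ⟨u, hu⟩ := DFunLike.ne_iff.mp hf
  obtain ⟨v, hv⟩ := DFunLike.ne_iff.mp hg
  simp only [LinearMap.zero_apply] at hu hv
  have gu := (mul_eq_zero.mp (h u)).resolve_left hu
  have fv := (mul_eq_zero.mp (h v)).resolve_right hv
  have := h (u + v)
  simp [gu, fv, hu, hv] at this

theorem lin_det_zero (p q r s : V →ₗ[ℝ] ℝ) (h : ∀ x, p x * s x = q x * r x) :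
    ∃ l m : ℝ, (l ≠ 0 ∨ m ≠ 0) ∧
      ((l • p + m • q = 0 ∧ l • r + m • s = 0) ∨ (l • p + m • r = 0 ∧ l • q + m • s = 0)) := by
  by_cases hp : p = 0
  · subst hp
    rcases lin_prod_zero q r (fun x => by rw [← h x]; simp) with hq | hr
    · exact ⟨1, 0, by simp, Or.inr (by simp [hq])⟩
    · exact ⟨1, 0, by simp, Or.inl (by simp [hr])⟩
  · obtain ⟨x0, hx⟩ := DFunLike.ne_iff.mp hp
    simp only [LinearMap.zero_apply] at hx
    rcases lin_prod_zero (q - (q x0 / p x0) • p) (r - (r x0 / p x0) • p) (fun x => by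
      have := h (x - (p x / p x0) • x0)
      simp only [map_sub, map_smul, smul_eq_mul] at this
      simp only [LinearMap.sub_apply, LinearMap.smul_apply, smul_eq_mul]
      have e : p x - p x / p x0 * p x0 = 0 := by field_simp; ring
      rw [e, zero_mul] at this
      rw [this]; ring) with hq | hr
    · rw [sub_eq_zero] at hq
      set t := q x0 / p x0
      have := (lin_prod_zero p (s - t • r) (fun x => by
        have := h x
        rw [hq] at this
        simp only [LinearMap.sub_apply, LinearMap.smul_apply, smul_eq_mul] at this ⊢
        linear_combination this)).resolve_left hp
      rw [sub_eq_zero] at this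
      exact ⟨t, -1, by simp, Or.inl ⟨by rw [hq]; module, by rw [this]; module⟩⟩
    · rw [sub_eq_zero] at hr
      set t := r x0 / p x0
      have := (lin_prod_zero p (s - t • q) (fun x => by
        have := h x
        rw [hr] at this
        simp only [LinearMap.sub_apply, LinearMap.smul_apply, smul_eq_mul] at this ⊢
        linear_combination this)).resolve_left hp
      rw [sub_eq_zero] at this
      exact ⟨t, -1, by simp, Or.inr ⟨by rw [hr]; module, by rw [this]; module⟩⟩
end forms

theorem exists_coord (w : Fin 3 → ℝ) (hw : w ≠ 0) :
    ∃ M : Mat3, IsUnit M.det ∧ w ᵥ* M = ![0, 0, 1] := by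
  obtain ⟨j, hj⟩ := Function.ne_iff.mp hw
  simp only [isUnit_iff_ne_zero]
  fin_cases j <;> simp at hj
  · refine ⟨!![-w 1, -w 2, 1 / w 0; w 0, 0, 0; 0, w 0, 0], ?_, ?_⟩
    · simp [Matrix.det_fin_three, hj]
    · ext i
      fin_cases i <;> simp [Matrix.vecMul, dotProduct, Fin.sum_univ_three, hj] <;> ring
  · refine ⟨!![w 1, 0, 0; -w 0, -w 2, 1 / w 1; 0, w 1, 0], ?_, ?_⟩
    · simp [Matrix.det_fin_three, hj]
    · ext i
      fin_cases i <;> simp [Matrix.vecMul, dotProduct, Fin.sum_univ_three, hj] <;> ring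
  · refine ⟨!![w 2, 0, 0; 0, w 2, 0; -w 0, -w 1, 1 / w 2], ?_, ?_⟩
    · simp [Matrix.det_fin_three, hj]
    · ext i
      fin_cases i <;> simp [Matrix.vecMul, dotProduct, Fin.sum_univ_three, hj] <;> ring

def EE : Mat3 := !![0, 0, 0; 0, 0, 0; 0, 0, 1]

theorem qf_EE (x : Fin 3 → ℝ) : qf EE x = x 2 ^ 2 := by
  simp [qf, EE, dotProduct, Matrix.mulVec, Fin.sum_univ_three]; ring

theorem qf_S (a b d e f g : ℝ) (x : Fin 3 → ℝ) : qf !![a, b, e; b, d, f; e, f, g] x =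
    a * x 0 ^ 2 + 2 * b * x 0 * x 1 + d * x 1 ^ 2 + 2 * e * x 0 * x 2 + 2 * f * x 1 * x 2
      + g * x 2 ^ 2 := by
  simp [qf, dotProduct, Matrix.mulVec, Fin.sum_univ_three]; ring

/-- Building an equivalence from explicit data. -/
theorem equiv_mk (a b d e f g : ℝ) (p q : (Fin 3 → ℝ) → ℝ) (M : Mat3) (α β γ : ℝ)
    (hM : M.det ≠ 0) (hα : α ≠ 0) (hγ : γ ≠ 0)
    (hp : ∀ ξ, p ξ = α * qf !![a, b, e; b, d, f; e, f, g] (M *ᵥ ξ) + β * qf EE (M *ᵥ ξ))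
    (hq : ∀ ξ, q ξ = γ * qf EE (M *ᵥ ξ)) :
    EquivPair !![a, b, e; b, d, f; e, f, g] EE p q := by
  refine ⟨M, !![α, β; 0, γ], isUnit_iff_ne_zero.mpr hM, ?_, fun ξ => ⟨?_, ?_⟩⟩
  · rw [Matrix.det_fin_two_of]; simp [hα, hγ]
  · simpa using hp ξ
  · simpa using hq ξ

theorem final_stage (a b d e f g : ℝ) (h : Irr2 !![a, b, e; b, d, f; e, f, g] EE) :
    EquivPair !![a, b, e; b, d, f; e, f, g] EE (fun ξ => ξ 0 ^ 2 + ξ 1 ^ 2) (fun ξ => ξ 2 ^ 2) ∨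
    EquivPair !![a, b, e; b, d, f; e, f, g] EE (fun ξ => ξ 0 ^ 2 - ξ 1 ^ 2) (fun ξ => ξ 2 ^ 2) ∨
    EquivPair !![a, b, e; b, d, f; e, f, g] EE
      (fun ξ => ξ 0 * ξ 1 + ξ 2 ^ 2) (fun ξ => ξ 0 ^ 2) := by
  by_cases ha : a = 0
  · subst ha
    by_cases hb : b = 0
    · subst hb
      by_cases hd : d = 0
      · subst hd
        exfalso
        have h1 := h.2 ![f, -e, 0]
          (by ext i; fin_cases i <;> simp [Matrix.mulVec, dotProduct, Fin.sum_univ_three]; ring)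
          (by ext i; fin_cases i <;> simp [EE, Matrix.mulVec, dotProduct, Fin.sum_univ_three])
        have hf : f = 0 := by simpa using congrFun h1 0
        have he : e = 0 := by simpa using congrFun h1 1
        subst hf he
        have := h.1 1 (-g) (by ext i j; fin_cases i <;> fin_cases j <;> simp [EE])
        simp at this
      · right; right
        have he : e ≠ 0 := by
          rintro rfl
          have h1 := h.2 ![1, 0, 0]
            (by ext i; fin_cases i <;> simp [Matrix.mulVec, dotProduct, Fin.sum_univ_three])
            (by ext i; fin_cases i <;> simp [EE, Matrix.mulVec, dotProduct, Fin.sum_univ_three])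
          simpa using congrFun h1 0
        refine equiv_mk _ _ _ _ _ _ _ _ !![0, d / (2 * e), 0; -f / d, 0, 1; 1, 0, 0] (1 / d)
          (-(g - f ^ 2 / d) / d) 1 ?_ (by positivity) one_ne_zero ?_ ?_
        · simp [Matrix.det_fin_three, hd, he]
        · intro ξ
          simp only [qf_S, qf_EE]
          simp [Matrix.mulVec, dotProduct, Fin.sum_univ_three]
          field_simp
          ring
        · intro ξ
          simp only [qf_EE]
          simp [Matrix.mulVec, dotProduct, Fin.sum_univ_three]
    · right; left
      refine equiv_mk _ _ _ _ _ _ _ _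
        !![(1 - d) / (2 * b), (1 + d) / (2 * b), (2 * d * e / b - 2 * f) / (2 * b);
           1, -1, -e / b; 0, 0, 1] 1
        (-(d * e ^ 2 / b ^ 2 - 2 * f * e / b + g)) 1 ?_ one_ne_zero one_ne_zero ?_ ?_
      · simp [Matrix.det_fin_three]
        field_simp
        ring_nf
        norm_num
      · intro ξ
        simp only [qf_S, qf_EE]
        simp [Matrix.mulVec, dotProduct, Fin.sum_univ_three]
        field_simp
        ring
      · intro ξ
        simp only [qf_EE]
        simp [Matrix.mulVec, dotProduct, Fin.sum_univ_three]
  · by_cases hD : a * d - b ^ 2 = 0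
    · right; right
      have hd : d = b ^ 2 / a := by field_simp; linarith
      have hf : a * f - b * e ≠ 0 := by
        intro hf
        have hf' : f = b * e / a := by field_simp; linarith
        subst hd hf'
        have h1 := h.2 ![-b / a, 1, 0]
          (by
            ext i
            fin_cases i <;> simp [Matrix.mulVec, dotProduct, Fin.sum_univ_three] <;>
              field_simp <;> ring)
          (by ext i; fin_cases i <;> simp [EE, Matrix.mulVec, dotProduct, Fin.sum_univ_three])
        simpa using congrFun h1 1
      obtain ⟨F, hF⟩ : ∃ F, F = a * f - b * e := ⟨_, rfl⟩
      rw [← hF] at hf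
      have hf' : f = (F + b * e) / a := by field_simp; linarith
      subst hd hf'
      refine equiv_mk _ _ _ _ _ _ _ _
        !![-e / a, -(b / a) * (a ^ 2 / (2 * F)), 1; 0, a ^ 2 / (2 * F), 0; 1, 0, 0] (1 / a)
          (-(g - e ^ 2 / a) / a) 1 ?_ (by positivity) one_ne_zero ?_ ?_
      · simp [Matrix.det_fin_three, ha, hf]
      · intro ξ
        simp only [qf_S, qf_EE]
        simp [Matrix.mulVec, dotProduct, Fin.sum_univ_three]
        field_simp
        ring
      · intro ξ
        simp only [qf_EE]
        simp [Matrix.mulVec, dotProduct, Fin.sum_univ_three]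
    · obtain ⟨D, hDD⟩ : ∃ D, D = a * d - b ^ 2 := ⟨_, rfl⟩
      rw [← hDD] at hD
      have hd : d = (D + b ^ 2) / a := by field_simp; linarith
      obtain ⟨F, hF⟩ : ∃ F, F = a * f - b * e := ⟨_, rfl⟩
      have hf' : f = (F + b * e) / a := by field_simp; linarith
      clear hDD hF
      subst hd hf'
      -- s ^ 2 = |D| , second coordinate scaled by a / s
      have main : ∀ s σ : ℝ, s ≠ 0 → D = σ * s ^ 2 →
          EquivPair !![a, b, e; b, (D + b ^ 2) / a, (F + b * e) / a; e, (F + b * e) / a, g] EE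
            (fun ξ => ξ 0 ^ 2 + σ * ξ 1 ^ 2) (fun ξ => ξ 2 ^ 2) := by
        intro s σ hs hσ
        have hσ0 : σ ≠ 0 := by rintro rfl; simp at hσ; exact hD hσ
        subst hσ
        refine equiv_mk _ _ _ _ _ _ _ _
          !![1, -(b / a) * (a / s), (b / a) * (F / (σ * s ^ 2)) - e / a;
             0, a / s, -F / (σ * s ^ 2); 0, 0, 1] (1 / a)
          (-(g - e ^ 2 / a - F ^ 2 / (a * (σ * s ^ 2))) / a) 1 ?_ (by positivity) one_ne_zero ?_ ?_
        · simp [Matrix.det_fin_three, ha, hs]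
        · intro ξ
          simp only [qf_S, qf_EE]
          simp [Matrix.mulVec, dotProduct, Fin.sum_univ_three]
          field_simp
          ring
        · intro ξ
          simp only [qf_EE]
          simp [Matrix.mulVec, dotProduct, Fin.sum_univ_three]
      rcases lt_or_gt_of_ne hD with hneg | hpos
      · right; left
        have := main (√(-D)) (-1) (by have := Real.sqrt_pos.mpr (neg_pos.mpr hneg); positivity)
          (by rw [Real.sq_sqrt (by linarith)]; ring)
        simpa [sub_eq_add_neg] using this
      · left
        have := main (√D) 1 (by positivity) (by rw [Real.sq_sqrt (by linarith)]; ring)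
        simpa using this

theorem second_stage (A B : Mat3) (hAs : A.IsSymm) (hBs : B.IsSymm) (h : Irr2 A B)
    (hdet : ∀ x : Fin 3 → ℝ, (A *ᵥ x) 0 * (B *ᵥ x) 1 = (A *ᵥ x) 1 * (B *ᵥ x) 0) :
    ∃ l m c : ℝ, c ≠ 0 ∧ l • A + m • B = c • EE := by
  obtain ⟨l, m, hlm, H⟩ := lin_det_zero
    ((LinearMap.proj 0).comp A.mulVecLin) ((LinearMap.proj 1).comp A.mulVecLin)
    ((LinearMap.proj 0).comp B.mulVecLin) ((LinearMap.proj 1).comp B.mulVecLin) hdet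
  have ev : ∀ (C : Mat3) (i j : Fin 3),
      ((LinearMap.proj i : (Fin 3 → ℝ) →ₗ[ℝ] ℝ).comp C.mulVecLin) (Pi.single j 1) = C i j := by
    intro C i j
    simp [Matrix.mulVec_single_one, Matrix.col]
  rcases H with ⟨H1, H2⟩ | ⟨H1, H2⟩
  · exfalso
    have k1 : ∀ j, l * A 0 j + m * A 1 j = 0 := fun j => by
      have := LinearMap.congr_fun H1 (Pi.single j 1)
      simpa only [LinearMap.add_apply, LinearMap.smul_apply, LinearMap.zero_apply, ev, smul_eq_mul] using this
    have k2 : ∀ j, l * B 0 j + m * B 1 j = 0 := fun j => by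
      have := LinearMap.congr_fun H2 (Pi.single j 1)
      simpa only [LinearMap.add_apply, LinearMap.smul_apply, LinearMap.zero_apply, ev, smul_eq_mul] using this
    have h1 := h.2 ![l, m, 0]
      (by
        ext j
        have := k1 j
        rw [← hAs.apply 0 j, ← hAs.apply 1 j] at this
        simp [Matrix.mulVec, dotProduct, Fin.sum_univ_three]
        linarith)
      (by
        ext j
        have := k2 j
        rw [← hBs.apply 0 j, ← hBs.apply 1 j] at this
        simp [Matrix.mulVec, dotProduct, Fin.sum_univ_three]
        linarith)
    have e1 : l = 0 := by simpa using congrFun h1 0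
    have e2 : m = 0 := by simpa using congrFun h1 1
    simp [e1, e2] at hlm
  · have k1 : ∀ j, l * A 0 j + m * B 0 j = 0 := fun j => by
      have := LinearMap.congr_fun H1 (Pi.single j 1)
      simpa only [LinearMap.add_apply, LinearMap.smul_apply, LinearMap.zero_apply, ev, smul_eq_mul] using this
    have k2 : ∀ j, l * A 1 j + m * B 1 j = 0 := fun j => by
      have := LinearMap.congr_fun H2 (Pi.single j 1)
      simpa only [LinearMap.add_apply, LinearMap.smul_apply, LinearMap.zero_apply, ev, smul_eq_mul] using this
    have heq : l • A + m • B = (l * A 2 2 + m * B 2 2) • EE := by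
      have a1 := hAs.apply 0 2
      have a2 := hAs.apply 1 2
      have b1 := hBs.apply 0 2
      have b2 := hBs.apply 1 2
      ext i j
      fin_cases i
      · have := k1 j
        fin_cases j <;> simpa [EE] using this
      · have := k2 j
        fin_cases j <;> simpa [EE] using this
      · fin_cases j
        · have := k1 2
          simp [EE, a1, b1]; linarith
        · have := k2 2
          simp [EE, a2, b2]; linarith
        · simp [EE]
    refine ⟨l, m, l * A 2 2 + m * B 2 2, fun hc => ?_, heq⟩
    rw [hc, zero_smul] at heq
    obtain ⟨e1, e2⟩ := h.1 l m heq
    simp [e1, e2] at hlm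

theorem classification_D_fails (A B : Mat3) (hAs : A.IsSymm) (hBs : B.IsSymm)
    (hirr : IrreduciblePair A B) (hD : ¬ DCond A B) :
    EquivPair A B (fun ξ => ξ 0 ^ 2 + ξ 1 ^ 2) (fun ξ => ξ 2 ^ 2) ∨
    EquivPair A B (fun ξ => ξ 0 ^ 2 - ξ 1 ^ 2) (fun ξ => ξ 2 ^ 2) ∨
    EquivPair A B (fun ξ => ξ 0 * ξ 1 + ξ 2 ^ 2) (fun ξ => ξ 0 ^ 2) := by
  have h0 := irr2_of A B hAs hBs hirr
  unfold DCond at hD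
  push Not at hD
  obtain ⟨w, hw, hdet⟩ := hD
  obtain ⟨M, hM, hMw⟩ := exists_coord w hw
  have sym : ∀ C : Mat3, C.IsSymm → (Mᵀ * C * M).IsSymm := by
    intro C hC
    unfold Matrix.IsSymm
    simp [Matrix.transpose_mul, hC.eq, Matrix.mul_assoc]
  have h1 := irr2_congr A B M hM h0
  have hA1 := sym A hAs
  have hB1 := sym B hBs
  have hdet1 : ∀ x : Fin 3 → ℝ, ((Mᵀ * A * M) *ᵥ x) 0 * ((Mᵀ * B * M) *ᵥ x) 1
      = ((Mᵀ * A * M) *ᵥ x) 1 * ((Mᵀ * B * M) *ᵥ x) 0 := by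
    intro x
    have e : (Matrix.of ![(2:ℝ) • ((Mᵀ * A * M) *ᵥ x), (2:ℝ) • ((Mᵀ * B * M) *ᵥ x), ![0, 0, 1]])
        = (Matrix.of ![(2:ℝ) • (A *ᵥ (M *ᵥ x)), (2:ℝ) • (B *ᵥ (M *ᵥ x)), w]) * M := by
      have t : ∀ C : Mat3, (Mᵀ * C * M) *ᵥ x = (C *ᵥ (M *ᵥ x)) ᵥ* M := by
        intro C
        rw [← Matrix.mulVec_transpose]
        simp [Matrix.mulVec_mulVec, Matrix.mul_assoc]
      rw [t, t, ← hMw]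
      ext i j
      rw [Matrix.mul_apply_eq_vecMul]
      fin_cases i
      · exact congrFun (Matrix.smul_vecMul (2:ℝ) (A *ᵥ (M *ᵥ x)) M).symm j
      · exact congrFun (Matrix.smul_vecMul (2:ℝ) (B *ᵥ (M *ᵥ x)) M).symm j
      · rfl
    have e2 := congrArg Matrix.det e
    rw [Matrix.det_mul, hdet, zero_mul, Matrix.det_fin_three] at e2
    simp at e2
    linarith
  obtain ⟨l, m, c, hc, hE⟩ := second_stage _ _ hA1 hB1 h1 hdet1
  suffices H : ∀ A1 B1 : Mat3, A1.IsSymm → B1.IsSymm → Irr2 A1 B1 → l • A1 + m • B1 = c • EE →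
      (EquivPair A1 B1 (fun ξ => ξ 0 ^ 2 + ξ 1 ^ 2) (fun ξ => ξ 2 ^ 2) ∨
      EquivPair A1 B1 (fun ξ => ξ 0 ^ 2 - ξ 1 ^ 2) (fun ξ => ξ 2 ^ 2) ∨
      EquivPair A1 B1 (fun ξ => ξ 0 * ξ 1 + ξ 2 ^ 2) (fun ξ => ξ 0 ^ 2)) by
    rcases H _ _ hA1 hB1 h1 hE with H | H | H
    · exact Or.inl (equiv_congr A B M hM _ _ H)
    · exact Or.inr (Or.inl (equiv_congr A B M hM _ _ H))
    · exact Or.inr (Or.inr (equiv_congr A B M hM _ _ H))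
  clear hE h1 hA1 hB1 hdet1
  intro A1 B1 hA1 hB1 h1 hE
  have hlm : l ^ 2 + m ^ 2 ≠ 0 := by
    intro h
    have hl : l = 0 := by nlinarith [sq_nonneg l, sq_nonneg m]
    have hm : m = 0 := by nlinarith [sq_nonneg l, sq_nonneg m]
    subst hl hm
    have := congrFun (congrFun hE 2) 2
    simp [EE] at this
    exact hc this.symm
  have hN : (-m) * (m / c) - l * (l / c) ≠ 0 := by
    have : (-m) * (m / c) - l * (l / c) = -(l ^ 2 + m ^ 2) / c := by field_simp; ring
    rw [this]
    exact div_ne_zero (neg_ne_zero.mpr hlm) hc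
  have hE2 : (l / c) • A1 + (m / c) • B1 = EE := by
    have : (l / c) • A1 + (m / c) • B1 = (1 / c) • (l • A1 + m • B1) := by
      rw [smul_add, smul_smul, smul_smul]; congr 2 <;> ring
    rw [this, hE, smul_smul, one_div_mul_cancel hc, one_smul]
  have h2 := irr2_pencil A1 B1 (-m) l (l / c) (m / c) hN h1
  rw [hE2] at h2
  have hC : ((-m) • A1 + l • B1).IsSymm := (hA1.smul _).add (hB1.smul _)
  obtain ⟨C, hCC⟩ : ∃ C : Mat3, C = (-m) • A1 + l • B1 := ⟨_, rfl⟩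
  rw [← hCC] at h2 hC
  have hC3 : C = !![C 0 0, C 0 1, C 0 2; C 0 1, C 1 1, C 1 2; C 0 2, C 1 2, C 2 2] := by
    have a1 := hC.apply 0 1
    have a2 := hC.apply 0 2
    have a3 := hC.apply 1 2
    ext i j
    fin_cases i <;> fin_cases j <;> simp [a1, a2, a3]
  rw [hC3] at h2
  have H := final_stage _ _ _ _ _ _ h2
  rw [← hC3, hCC, ← hE2] at H
  rcases H with H | H | H
  · exact Or.inl (equiv_pencil A1 B1 _ _ _ _ hN _ _ H)
  · exact Or.inr (Or.inl (equiv_pencil A1 B1 _ _ _ _ hN _ _ H))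
  · exact Or.inr (Or.inr (equiv_pencil A1 B1 _ _ _ _ hN _ _ H))
end
end

section
/- Let (P, Q) be an irreducible pair of real quadratic forms on ℝ³ that satisfies the (D) condition and the (R₀) condition. Then (P, Q) is equivalent to (ξ₁ξ₂, ξ₁ξ₃). -/
open MeasureTheory Matrix

noncomputable section

lemma aux_rank {N : Matrix (Fin 3) (Fin 2) ℝ} (h : N.rank = 2) :
    crossProduct (N.col 0) (N.col 1) ≠ 0 := by
  rw [crossProduct_ne_zero_iff_linearIndependent]
  have h1 : LinearIndependent ℝ N.col := by
    rw [linearIndependent_iff_card_eq_finrank_span, Set.finrank, ← Matrix.rank_eq_finrank_span_cols, h]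
    simp
  have h2 : ![N.col 0, N.col 1] = N.col := by
    ext i j
    fin_cases i <;> rfl
  rw [h2]
  exact h1

lemma aux_null {S : Mat3} {N : Matrix (Fin 3) (Fin 2) ℝ} (h : (Nᵀ * hess S * N).rank ≤ 0) (i j : Fin 2) :
    N.col i ⬝ᵥ S *ᵥ N.col j = 0 := by
  have h0 : Nᵀ * hess S * N = 0 := by
    have h1 := Nat.le_zero.1 h
    rw [Matrix.rank, Submodule.finrank_eq_zero, LinearMap.range_eq_bot] at h1
    ext i j
    have h2 := congrFun (LinearMap.congr_fun h1 (Pi.single j 1)) i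
    rw [Matrix.mulVecLin_apply, Matrix.mulVec_single_one] at h2
    exact h2
  have h1 := congrFun (congrFun h0 i) j
  simp [hess, Matrix.mul_apply, Matrix.mulVec, dotProduct, Fin.sum_univ_succ] at h1 ⊢
  linarith

lemma aux_qf {S : Mat3} (hS : S.IsSymm) (u v w : Fin 3 → ℝ) (x y z : ℝ) :
    qf S (x • u + y • v + z • w) = x^2 * (u ⬝ᵥ S *ᵥ u) + y^2 * (v ⬝ᵥ S *ᵥ v) + z^2 * (w ⬝ᵥ S *ᵥ w)
      + 2 * x * y * (u ⬝ᵥ S *ᵥ v) + 2 * x * z * (u ⬝ᵥ S *ᵥ w) + 2 * y * z * (v ⬝ᵥ S *ᵥ w) := by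
  have a := hS.apply 0 1
  have b := hS.apply 0 2
  have c := hS.apply 1 2
  simp [qf, Matrix.mulVec, dotProduct, Fin.sum_univ_succ] at *
  rw [a, b, c]
  ring

lemma aux_comm {S : Mat3} (hS : S.IsSymm) (u v : Fin 3 → ℝ) :
    u ⬝ᵥ S *ᵥ v = v ⬝ᵥ S *ᵥ u := by
  rw [Matrix.dotProduct_mulVec, ← Matrix.mulVec_transpose, hS.eq, dotProduct_comm]

lemma aux_perp (u : Fin 3 → ℝ) : ∃ w : Fin 3 → ℝ, w ≠ 0 ∧ w ⬝ᵥ u = 0 := by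
  by_cases h : u 0 = 0
  · exact ⟨![1, 0, 0], fun h => by simpa using congrFun h 0, by
      simp [dotProduct, Fin.sum_univ_succ, h]⟩
  · refine ⟨![u 1, - u 0, 0], fun h' => h (by simpa using congrFun h' 1), ?_⟩
    simp [dotProduct, Fin.sum_univ_succ]; ring

lemma aux_D {A B : Mat3} (hAs : A.IsSymm) (hBs : B.IsSymm) (hD : DCond A B) {u : Fin 3 → ℝ}
    (hu : u ≠ 0) (hA : A *ᵥ u = 0) (hB : B *ᵥ u = 0) : False := by
  obtain ⟨w, hw, hwu⟩ := aux_perp u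
  obtain ⟨ξ, hξ⟩ := hD w hw
  apply hξ
  rw [← Matrix.exists_mulVec_eq_zero_iff]
  refine ⟨u, hu, ?_⟩
  have e1 : (A *ᵥ ξ) ⬝ᵥ u = 0 := by rw [dotProduct_comm, aux_comm hAs, hA, dotProduct_zero]
  have e2 : (B *ᵥ ξ) ⬝ᵥ u = 0 := by rw [dotProduct_comm, aux_comm hBs, hB, dotProduct_zero]
  ext i
  fin_cases i
  · show ((2:ℝ) • (A *ᵥ ξ)) ⬝ᵥ u = 0
    rw [smul_dotProduct, e1, smul_zero]
  · show ((2:ℝ) • (B *ᵥ ξ)) ⬝ᵥ u = 0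
    rw [smul_dotProduct, e2, smul_zero]
  · exact hwu

lemma aux_zero {u v w x : Fin 3 → ℝ} (hd : (Matrix.of ![u, v, w]).det ≠ 0)
    (h1 : u ⬝ᵥ x = 0) (h2 : v ⬝ᵥ x = 0) (h3 : w ⬝ᵥ x = 0) : x = 0 := by
  by_contra hx
  apply hd
  rw [← Matrix.exists_mulVec_eq_zero_iff]
  refine ⟨x, hx, ?_⟩
  ext i
  fin_cases i
  · exact h1
  · exact h2
  · exact h3

theorem classification_D_R0 (A B : Mat3) (hAs : A.IsSymm) (hBs : B.IsSymm)
    (hirr : IrreduciblePair A B) (hD : DCond A B) (hR : RCond A B 0) :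
    EquivPair A B (fun ξ => ξ 0 * ξ 1) (fun ξ => ξ 0 * ξ 2) := by
  obtain ⟨⟨N, hN, hl⟩, -⟩ := hR
  have hc := aux_rank hN
  have hA := fun i j => aux_null (S := A) (N := N) (by simpa using hl 1 0) i j
  have hB := fun i j => aux_null (S := B) (N := N) (by simpa using hl 0 1) i j
  have A00 := hA 0 0
  have A01 := hA 0 1
  have A10 := hA 1 0
  have A11 := hA 1 1
  have B00 := hB 0 0
  have B01 := hB 0 1
  have B10 := hB 1 0
  have B11 := hB 1 1
  clear hA hB hl hN
  generalize N.col 0 = n at *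
  generalize N.col 1 = m at *
  obtain ⟨v, hv⟩ : ∃ v, v = crossProduct n m := ⟨_, rfl⟩
  have hdet : (Matrix.of ![v, n, m]).det ≠ 0 := by
    have : (Matrix.of ![v, n, m]).det = v ⬝ᵥ v := by
      conv_rhs => rw [hv]
      rw [hv]
      simp [Matrix.det_fin_three, dotProduct, crossProduct, Fin.sum_univ_succ]
      ring
    rw [this, Ne, dotProduct_self_eq_zero, hv]
    exact hc
  clear hv hc
  obtain ⟨a, ha⟩ : ∃ a, a = v ⬝ᵥ A *ᵥ v := ⟨_, rfl⟩
  obtain ⟨b, hb⟩ : ∃ b, b = v ⬝ᵥ A *ᵥ n := ⟨_, rfl⟩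
  obtain ⟨c, hc⟩ : ∃ c, c = v ⬝ᵥ A *ᵥ m := ⟨_, rfl⟩
  obtain ⟨a', ha'⟩ : ∃ a, a = v ⬝ᵥ B *ᵥ v := ⟨_, rfl⟩
  obtain ⟨b', hb'⟩ : ∃ b, b = v ⬝ᵥ B *ᵥ n := ⟨_, rfl⟩
  obtain ⟨c', hc'⟩ : ∃ c, c = v ⬝ᵥ B *ᵥ m := ⟨_, rfl⟩
  by_cases hDD : b * c' - b' * c = 0
  · exfalso
    obtain ⟨t, ht, h0⟩ : ∃ t : Fin 2 → ℝ, t ≠ 0 ∧ !![b, c; b', c'] *ᵥ t = 0 := by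
      rw [Matrix.exists_mulVec_eq_zero_iff, Matrix.det_fin_two_of]; linarith
    have h1 : b * t 0 + c * t 1 = 0 := by
      simpa [Matrix.mulVec, dotProduct, Fin.sum_univ_succ] using congrFun h0 0
    have h2 : b' * t 0 + c' * t 1 = 0 := by
      simpa [Matrix.mulVec, dotProduct, Fin.sum_univ_succ] using congrFun h0 1
    refine aux_D hAs hBs hD (u := t 0 • n + t 1 • m) ?_ ?_ ?_
    · intro hu
      apply ht
      have h3 : ![0, t 0, t 1] ᵥ* (Matrix.of ![v, n, m]) = 0 := by
        rw [← hu]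
        ext i
        simp [Matrix.vecMul, dotProduct, Fin.sum_univ_succ]
      have h4 : ![0, t 0, t 1] = 0 := by
        by_contra h5
        exact hdet (Matrix.exists_vecMul_eq_zero_iff.1 ⟨_, h5, h3⟩)
      ext i
      fin_cases i
      · simpa using congrFun h4 1
      · simpa using congrFun h4 2
    · apply aux_zero hdet <;> simp only [Matrix.mulVec_add, Matrix.mulVec_smul, dotProduct_add, dotProduct_smul, ← hb, ← hc, A00, A01, A10, A11, smul_eq_mul] <;> linarith
    · apply aux_zero hdet <;> simp only [Matrix.mulVec_add, Matrix.mulVec_smul, dotProduct_add, dotProduct_smul, ← hb', ← hc', B00, B01, B10, B11, smul_eq_mul] <;> linarith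
  · obtain ⟨D, hDe⟩ : ∃ D, D = b * c' - b' * c := ⟨_, rfl⟩
    rw [← hDe] at hDD
    obtain ⟨α, hα⟩ : ∃ x, x = (a * c' - a' * c) / (2 * D) := ⟨_, rfl⟩
    obtain ⟨β, hβ⟩ : ∃ x, x = (b * a' - b' * a) / (2 * D) := ⟨_, rfl⟩
    have key : ∀ ξ : Fin 3 → ℝ, (Matrix.of ![v - α • n - β • m, n, m])ᵀ *ᵥ ξ =
        ξ 0 • v + (ξ 1 - α * ξ 0) • n + (ξ 2 - β * ξ 0) • m := by
      intro ξ
      ext i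
      simp [Matrix.mulVec, dotProduct, Fin.sum_univ_succ]
      ring
    refine ⟨(Matrix.of ![v - α • n - β • m, n, m])ᵀ,
      !![c' / (2 * D), -c / (2 * D); -b' / (2 * D), b / (2 * D)], ?_, ?_, ?_⟩
    · rw [Matrix.det_transpose, isUnit_iff_ne_zero]
      convert hdet using 1
      simp [Matrix.det_fin_three]
      ring
    · rw [Matrix.det_fin_two_of, isUnit_iff_ne_zero]
      have : c' / (2 * D) * (b / (2 * D)) - -c / (2 * D) * (-b' / (2 * D)) = 1 / (4 * D) := by
        field_simp
        rw [hDe]; ring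
      rw [this]
      positivity
    · intro ξ
      rw [key, aux_qf hAs, aux_qf hBs, ← ha, ← hb, ← hc, ← ha', ← hb', ← hc', A00, A01, A11,
        B00, B01, B11, hα, hβ]
      simp
      constructor
      · field_simp
        rw [hDe]; ring
      · field_simp
        rw [hDe]; ring
end
end
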